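/- Let d ≥ 3 and n_1,…,n_d be positive integers, let r ≥ 1, set n = max{n_i : 1 ≤ i ≤ d}, and let S be the set of tensors X ∈ ℝ^{n_1×⋯×n_d} with ‖X‖_F = 1 such that rank(X^{{k}}) ≤ r for every k ∈ {1,…,d} and rank(X^{{j,j+1,…,d}}) ≤ r for every j ∈ {2,…,d−1} (the matricizations associated with the nodes of the tensor-train tree). Then for every ε with 0 < ε ≤ 1 there exists a finite set N of tensors in ℝ^{n_1×⋯×n_d} with cardinality |N| ≤ (3(2d−1)√r/ε)^{(d−1)·r³ + d·n·r} such that for every X ∈ S there exists X̄ ∈ N with ‖X − X̄‖_F ≤ ε. -/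

import Mathlib

open scoped BigOperators

noncomputable section

/-- Frobenius norm of a tensor given as a scalar-valued function on a finite index set. -/
def frob {ι : Type*} [Fintype ι] (X : ι → ℝ) : ℝ :=
  Real.sqrt (∑ j, X j ^ 2)

/-- The `S`-matricization of an order-`d` tensor, with rows and columns indexed
(redundantly) by full multi-indices: entry `(a, b)` is `X` evaluated at the multi-index
that agrees with `a` on `S` and with `b` outside `S`.  Its rank coincides with the rank
of the usual `S`-matricization. -/
def matricize {d : ℕ} (n : Fin d → ℕ) (𝕜 : Type*) (S : Finset (Fin d))
    (X : (∀ i, Fin (n i)) → 𝕜) :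
    Matrix (∀ i, Fin (n i)) (∀ i, Fin (n i)) 𝕜 :=
  Matrix.of fun a b => X (fun i => if i ∈ S then a i else b i)


section Net

open MeasureTheory Metric Module
open scoped ENNReal

/-- Volume bound for finite `δ`-separated subsets of the unit ball. -/
lemma card_le_of_separated_unitBall {E : Type*} [NormedAddCommGroup E] [NormedSpace ℝ E]
    [FiniteDimensional ℝ E] {δ : ℝ} (hδ0 : 0 < δ) (hδ1 : δ ≤ 1) (s : Finset E)
    (hs : ∀ c ∈ s, ‖c‖ ≤ 1) (h : ∀ c ∈ s, ∀ d ∈ s, c ≠ d → δ ≤ ‖c - d‖) :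
    (s.card : ℝ) ≤ (3 / δ) ^ finrank ℝ E := by
  borelize E
  let μ : Measure E := Measure.addHaar
  have hδ2 : 0 < δ / 2 := by positivity
  have hρ : 0 < 1 + δ / 2 := by positivity
  have D : Set.Pairwise (s : Set E) (Function.onFun Disjoint fun c => ball (c : E) (δ / 2)) := by
    rintro c hc d hd hcd
    apply ball_disjoint_ball
    rw [dist_eq_norm, add_halves]
    exact h c hc d hd hcd
  have A_subset : (⋃ c ∈ s, ball (c : E) (δ / 2)) ⊆ ball (0 : E) (1 + δ / 2) := by
    refine Set.iUnion₂_subset fun x hx => ball_subset_ball' ?_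
    rw [dist_zero_right]
    linarith [hs x hx]
  have I : (s.card : ℝ≥0∞) * ENNReal.ofReal ((δ / 2) ^ finrank ℝ E) * μ (ball 0 1) ≤
      ENNReal.ofReal ((1 + δ / 2) ^ finrank ℝ E) * μ (ball 0 1) :=
    calc
      _ = μ (⋃ c ∈ s, ball (c : E) (δ / 2)) := by
        rw [measure_biUnion_finset D fun c _ => measurableSet_ball]
        simp only [μ.addHaar_ball_of_pos _ hδ2, Finset.sum_const, nsmul_eq_mul, mul_assoc]
      _ ≤ μ (ball (0 : E) (1 + δ / 2)) := measure_mono A_subset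
      _ = _ := μ.addHaar_ball_of_pos _ hρ
  have J := (ENNReal.mul_le_mul_iff_left (measure_ball_pos _ _ zero_lt_one).ne'
    measure_ball_lt_top.ne).1 I
  have K : (s.card : ℝ) * (δ / 2) ^ finrank ℝ E ≤ (1 + δ / 2) ^ finrank ℝ E := by
    have := ENNReal.toReal_le_of_le_ofReal (by positivity) J
    simpa [ENNReal.toReal_mul, ENNReal.toReal_ofReal (pow_nonneg hδ2.le _)] using this
  calc (s.card : ℝ) ≤ (1 + δ / 2) ^ finrank ℝ E / (δ / 2) ^ finrank ℝ E :=
        (le_div_iff₀ (by positivity)).2 K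
    _ = ((1 + δ / 2) / (δ / 2)) ^ finrank ℝ E := (div_pow _ _ _).symm
    _ ≤ (3 / δ) ^ finrank ℝ E := by
        gcongr ?_ ^ _
        rw [div_le_div_iff₀ hδ2 hδ0]
        nlinarith

/-- The unit ball of a finite-dimensional space `E` has a `δ`-net of at most
`(3 / δ) ^ dim E` points. -/
lemma exists_net_unitBall (E : Type*) [NormedAddCommGroup E] [NormedSpace ℝ E]
    [FiniteDimensional ℝ E] {δ : ℝ} (hδ0 : 0 < δ) (hδ1 : δ ≤ 1) :
    ∃ N : Finset E, (N.card : ℝ) ≤ (3 / δ) ^ finrank ℝ E ∧ (∀ y ∈ N, ‖y‖ ≤ 1) ∧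
      ∀ x : E, ‖x‖ ≤ 1 → ∃ y ∈ N, ‖x - y‖ ≤ δ := by
  classical
  let P : ℕ → Prop := fun c => ∃ s : Finset E, s.card = c ∧ (∀ c ∈ s, ‖c‖ ≤ 1) ∧
    ∀ c ∈ s, ∀ d ∈ s, c ≠ d → δ ≤ ‖c - d‖
  have hP : ∀ c, P c → c ≤ ⌊(3 / δ) ^ finrank ℝ E⌋₊ := by
    rintro _ ⟨s, rfl, h1, h2⟩
    exact Nat.le_floor (card_le_of_separated_unitBall hδ0 hδ1 s h1 h2)
  have h0 : P 0 := ⟨∅, by simp⟩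
  obtain ⟨s, hs, h1, h2⟩ := Nat.findGreatest_spec (Nat.zero_le ⌊(3 / δ) ^ finrank ℝ E⌋₊) h0
  refine ⟨s, card_le_of_separated_unitBall hδ0 hδ1 s h1 h2, h1, fun x hx => ?_⟩
  by_contra! hcon
  have hxs : x ∉ s := fun hxs => by
    have := hcon x hxs
    rw [sub_self, norm_zero] at this
    linarith
  have hins : P (s.card + 1) := by
    refine ⟨insert x s, Finset.card_insert_of_notMem hxs, ?_, ?_⟩
    · simpa [hx] using h1
    · intro c hc d hd hcd
      rcases Finset.mem_insert.1 hc with hcx | hcs <;>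
        rcases Finset.mem_insert.1 hd with hdx | hds
      · exact absurd (hcx.trans hdx.symm) hcd
      · exact hcx ▸ (hcon d hds).le
      · rw [norm_sub_rev]
        exact hdx ▸ (hcon c hcs).le
      · exact h2 c hcs d hds hcd
  have hle : s.card + 1 ≤ Nat.findGreatest P ⌊(3 / δ) ^ finrank ℝ E⌋₊ :=
    Nat.le_findGreatest (hP _ hins) hins
  exact absurd (hs ▸ hle) (by simp)

end Net

section OperatorNorm

open scoped Matrix Matrix.Norms.L2Operator

lemma l2_opNorm_le_of_sum_sq {I J : Type*} [Fintype I] [Fintype J] [DecidableEq J]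
    {A : Matrix I J ℝ} {c : ℝ} (hc : 0 ≤ c)
    (h : ∀ x : J → ℝ, ∑ i, (A *ᵥ x) i ^ 2 ≤ c ^ 2 * ∑ j, x j ^ 2) : ‖A‖ ≤ c := by
  rw [Matrix.l2_opNorm_def]
  refine ContinuousLinearMap.opNorm_le_bound _ hc fun x => ?_
  rw [← sq_le_sq₀ (norm_nonneg _) (by positivity), mul_pow, EuclideanSpace.norm_sq_eq,
    EuclideanSpace.norm_sq_eq]
  simpa using h x

lemma sum_sq_mulVec_le {I J : Type*} [Fintype I] [Fintype J] [DecidableEq J]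
    (A : Matrix I J ℝ) (x : J → ℝ) :
    ∑ i, (A *ᵥ x) i ^ 2 ≤ ‖A‖ ^ 2 * ∑ j, x j ^ 2 := by
  have h := A.l2_opNorm_mulVec (WithLp.toLp 2 x)
  rw [← sq_le_sq₀ (norm_nonneg _) (by positivity), mul_pow, EuclideanSpace.norm_sq_eq,
    EuclideanSpace.norm_sq_eq] at h
  simpa using h

lemma frob_mulVec_le {I J : Type*} [Fintype I] [Fintype J] [DecidableEq J]
    (A : Matrix I J ℝ) (x : J → ℝ) : frob (A *ᵥ x) ≤ ‖A‖ * frob x := by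
  unfold frob
  refine Real.sqrt_le_iff.2 ⟨by positivity, ?_⟩
  rw [mul_pow, Real.sq_sqrt (by positivity)]
  exact sum_sq_mulVec_le A x

/-- The tensor product of two matrices, with row multi-indices joined by `Fin.cons`. -/
def consKronecker {k : ℕ} {m : Fin (k + 1) → ℕ} {P Q : Type*}
    (U : Matrix (Fin (m 0)) P ℝ) (V : Matrix (∀ i : Fin k, Fin (m i.succ)) Q ℝ) :
    Matrix (∀ i, Fin (m i)) (P × Q) ℝ :=
  Matrix.of fun a pq => U (a 0) pq.1 * V (fun i => a i.succ) pq.2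

lemma sum_consIndex {k : ℕ} {m : Fin (k + 1) → ℕ} (f : (∀ i, Fin (m i)) → ℝ) :
    ∑ a, f a = ∑ i : Fin (m 0), ∑ b : (∀ i : Fin k, Fin (m i.succ)), f (Fin.cons i b) := by
  rw [← Fintype.sum_prod_type', ← (Fin.consEquiv fun i => Fin (m i)).sum_comp]
  rfl

variable {k : ℕ} {m : Fin (k + 1) → ℕ} {P Q : Type*}

lemma consKronecker_sub_left (U U' : Matrix (Fin (m 0)) P ℝ)
    (V : Matrix (∀ i : Fin k, Fin (m i.succ)) Q ℝ) :
    consKronecker (U - U') V = consKronecker U V - consKronecker U' V := by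
  ext a pq
  simp [consKronecker, sub_mul]

lemma consKronecker_sub_right (U : Matrix (Fin (m 0)) P ℝ)
    (V V' : Matrix (∀ i : Fin k, Fin (m i.succ)) Q ℝ) :
    consKronecker U (V - V') = consKronecker U V - consKronecker U V' := by
  ext a pq
  simp [consKronecker, mul_sub]

variable [Fintype P] [Fintype Q] [DecidableEq P] [DecidableEq Q]

lemma norm_consKronecker_le (U : Matrix (Fin (m 0)) P ℝ)
    (V : Matrix (∀ i : Fin k, Fin (m i.succ)) Q ℝ) :
    ‖consKronecker U V‖ ≤ ‖U‖ * ‖V‖ := by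
  refine l2_opNorm_le_of_sum_sq (by positivity) fun x => ?_
  have key : ∀ i b, (consKronecker U V *ᵥ x) (Fin.cons i b) =
      (U *ᵥ fun p => (V *ᵥ fun q => x (p, q)) b) i := by
    intro i b
    simp only [Matrix.mulVec, dotProduct, consKronecker, Matrix.of_apply, Fin.cons_zero,
      Fin.cons_succ, Fintype.sum_prod_type, Finset.mul_sum, mul_assoc]
  rw [sum_consIndex, Finset.sum_comm]
  simp only [key]
  calc ∑ b, ∑ i, (U *ᵥ fun p => (V *ᵥ fun q => x (p, q)) b) i ^ 2
      ≤ ∑ b, ‖U‖ ^ 2 * ∑ p, (V *ᵥ fun q => x (p, q)) b ^ 2 :=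
        Finset.sum_le_sum fun b _ => sum_sq_mulVec_le _ _
    _ = ‖U‖ ^ 2 * ∑ p, ∑ b, (V *ᵥ fun q => x (p, q)) b ^ 2 := by
        rw [← Finset.mul_sum, Finset.sum_comm]
    _ ≤ ‖U‖ ^ 2 * ∑ p, ‖V‖ ^ 2 * ∑ q, x (p, q) ^ 2 := by
        gcongr
        exact sum_sq_mulVec_le _ _
    _ = (‖U‖ * ‖V‖) ^ 2 * ∑ j, x j ^ 2 := by
        rw [← Finset.mul_sum, Fintype.sum_prod_type]
        ring

lemma norm_consKronecker_mul_sub_le {R : Type*} [Fintype R] [DecidableEq R]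
    {U U' : Matrix (Fin (m 0)) P ℝ} {V V' : Matrix (∀ i : Fin k, Fin (m i.succ)) Q ℝ}
    {C C' : Matrix (P × Q) R ℝ} (hU' : ‖U'‖ ≤ 1) (hV : ‖V‖ ≤ 1) (hV' : ‖V'‖ ≤ 1)
    (hC : ‖C‖ ≤ 1) :
    ‖consKronecker U V * C - consKronecker U' V' * C'‖ ≤
      ‖U - U'‖ + ‖V - V'‖ + ‖C - C'‖ := by
  have h : consKronecker U V * C - consKronecker U' V' * C' =
      consKronecker (U - U') V * C + consKronecker U' (V - V') * C +
        consKronecker U' V' * (C - C') := by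
    rw [consKronecker_sub_left, consKronecker_sub_right, Matrix.sub_mul,
      Matrix.sub_mul, Matrix.mul_sub]
    abel
  have hmul : ∀ (A : Matrix (Fin (m 0)) P ℝ) (B : Matrix (∀ i : Fin k, Fin (m i.succ)) Q ℝ)
      (D : Matrix (P × Q) R ℝ), ‖consKronecker A B * D‖ ≤ ‖A‖ * ‖B‖ * ‖D‖ := fun A B D =>
    (Matrix.l2_opNorm_mul _ _).trans (by gcongr; exact norm_consKronecker_le A B)
  rw [h]
  refine (norm_add₃_le).trans (add_le_add (add_le_add ?_ ?_) ?_)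
  · refine (hmul _ _ _).trans ?_
    rw [mul_assoc]
    exact mul_le_of_le_one_right (norm_nonneg _) (mul_le_one₀ hV (norm_nonneg _) hC)
  · refine (hmul _ _ _).trans ?_
    rw [mul_comm ‖U'‖, mul_assoc]
    exact mul_le_of_le_one_right (norm_nonneg _) (mul_le_one₀ hU' (norm_nonneg _) hC)
  · exact (hmul _ _ _).trans (mul_le_of_le_one_left (norm_nonneg _)
      (mul_le_one₀ hU' (norm_nonneg _) hV'))

/-- A subspace of dimension at most `r` is fixed by `V * Vᴴ` for some contraction `V` with `r`
columns. -/
lemma exists_contraction_fixing {J : Type*} [Fintype J] [DecidableEq J] {r : ℕ}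
    (T : Submodule ℝ (J → ℝ)) (hT : Module.finrank ℝ T ≤ r) :
    ∃ V : Matrix J (Fin r) ℝ, ‖V‖ ≤ 1 ∧ (∀ p, V.col p ∈ T) ∧
      ∀ t ∈ T, (V * Vᴴ) *ᵥ t = t := by
  let L := (WithLp.linearEquiv 2 ℝ (J → ℝ)).symm
  have hf : Module.finrank ℝ (T.map L.toLinearMap) ≤ r :=
    (Submodule.finrank_map_le _ _).trans hT
  let b := stdOrthonormalBasis ℝ (T.map L.toLinearMap)
  let v : Fin r → EuclideanSpace ℝ J := fun p =>
    if h : (p : ℕ) < Module.finrank ℝ (T.map L.toLinearMap) then (b ⟨p, h⟩ : EuclideanSpace ℝ J)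
    else 0
  let V : Matrix J (Fin r) ℝ := Matrix.of fun j p => v p j
  have hmem : ∀ p, V.col p ∈ T := by
    intro p
    have : v p ∈ T.map L.toLinearMap := by
      simp only [v]
      split_ifs
      · exact Subtype.coe_prop _
      · exact zero_mem _
    obtain ⟨t, ht, htv⟩ := this
    have : V.col p = t := by
      ext j
      simp [V, ← htv, L]
    rwa [this]
  have hdiag : Vᴴ * V = Matrix.diagonal fun p : Fin r =>
      if (p : ℕ) < Module.finrank ℝ (T.map L.toLinearMap) then (1 : ℝ) else 0 := by
    ext p q
    have hin : (Vᴴ * V) p q = inner ℝ (v p) (v q) := by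
      simp [Matrix.mul_apply, V, PiLp.inner_apply, mul_comm]
    rw [hin, Matrix.diagonal_apply]
    by_cases hp : (p : ℕ) < Module.finrank ℝ (T.map L.toLinearMap)
    · by_cases hq : (q : ℕ) < Module.finrank ℝ (T.map L.toLinearMap)
      · simp only [v, hp, hq, dif_pos, if_true]
        rw [← Submodule.coe_inner, orthonormal_iff_ite.1 b.orthonormal]
        simp [Fin.ext_iff]
      · have : p ≠ q := fun h => hq (h ▸ hp)
        simp [v, hq, this]
    · simp [v, hp]
  refine ⟨V, ?_, hmem, fun t ht => ?_⟩
  · have h1 : ‖V‖ * ‖V‖ ≤ 1 := by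
      rw [← Matrix.l2_opNorm_conjTranspose_mul_self, hdiag, Matrix.l2_opNorm_diagonal]
      refine (pi_norm_le_iff_of_nonneg zero_le_one).2 fun p => ?_
      split_ifs <;> simp
    nlinarith [norm_nonneg V]
  · have hLt : L t ∈ T.map L.toLinearMap := ⟨t, ht, rfl⟩
    have hsum := congrArg (Subtype.val) (b.sum_repr' ⟨L t, hLt⟩)
    have hsum2 : ∑ p, inner ℝ (v p) (L t) • v p = L t := by
      rw [← Fintype.sum_of_injective (Fin.castLE hf) (Fin.castLE_injective hf)
        (fun i => inner ℝ (b i : EuclideanSpace ℝ J) (L t) • (b i : EuclideanSpace ℝ J))]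
      · simpa using hsum
      · intro p hp
        have : ¬ (p : ℕ) < Module.finrank ℝ (T.map L.toLinearMap) := fun h => hp ⟨⟨p, h⟩, rfl⟩
        simp [v, this]
      · intro i
        simp [v]
    ext j
    have hj := congrArg (fun e : EuclideanSpace ℝ J => e j) hsum2
    rw [← Matrix.mulVec_mulVec]
    simp only [PiLp.inner_apply, WithLp.ofLp_sum, Finset.sum_apply, PiLp.smul_apply] at hj
    simpa [Matrix.mulVec, dotProduct, V, L, mul_comm] using hj

end OperatorNorm


section Slices

variable {d : ℕ} {n : Fin d → ℕ}

/-- The span of all `S`-slices of the members of `T`, as functions that ignore the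
coordinates outside `S`. -/
def sliceSpan (S : Finset (Fin d)) (T : Submodule ℝ ((∀ i, Fin (n i)) → ℝ)) :
    Submodule ℝ ((∀ i, Fin (n i)) → ℝ) :=
  Submodule.span ℝ {f | ∃ t ∈ T, ∃ b : ∀ i, Fin (n i),
    f = fun a => t fun i => if i ∈ S then a i else b i}

/-- The coordinates with index at least `j`. -/
def suffix (d j : ℕ) : Finset (Fin d) := Finset.univ.filter fun i => j ≤ (i : ℕ)

lemma finrank_sliceSpan_span_singleton_le (S : Finset (Fin d)) (X : (∀ i, Fin (n i)) → ℝ) :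
    Module.finrank ℝ (sliceSpan S (Submodule.span ℝ {X})) ≤ (matricize n ℝ S X).rank := by
  rw [Matrix.rank_eq_finrank_span_cols]
  refine Submodule.finrank_mono (Submodule.span_le.2 ?_)
  rintro _ ⟨t, ht, b, rfl⟩
  obtain ⟨c, rfl⟩ := Submodule.mem_span_singleton.1 ht
  exact Submodule.smul_mem _ c (Submodule.subset_span ⟨b, rfl⟩)

variable {k : ℕ} {m : Fin (k + 1) → ℕ}

/-- The span of the fibers of the members of `T` along the first coordinate. -/
def headSpan (T : Submodule ℝ ((∀ i, Fin (m i)) → ℝ)) : Submodule ℝ (Fin (m 0) → ℝ) :=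
  Submodule.span ℝ {f | ∃ t ∈ T, ∃ b : ∀ i : Fin k, Fin (m i.succ), f = fun a => t (Fin.cons a b)}

/-- The span of the slices of the members of `T` obtained by fixing the first coordinate. -/
def tailSpan (T : Submodule ℝ ((∀ i, Fin (m i)) → ℝ)) :
    Submodule ℝ ((∀ i : Fin k, Fin (m i.succ)) → ℝ) :=
  Submodule.span ℝ {f | ∃ t ∈ T, ∃ a : Fin (m 0), f = fun b => t (Fin.cons a b)}

lemma finrank_le_of_map_funLeft_le {I J : Type*} [Finite I] {g : I → J} (hg : g.Surjective)
    {T : Submodule ℝ (J → ℝ)} {T' : Submodule ℝ (I → ℝ)}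
    (h : T.map (LinearMap.funLeft ℝ ℝ g) ≤ T') : Module.finrank ℝ T ≤ Module.finrank ℝ T' := by
  rw [(Submodule.equivMapOfInjective _ (LinearMap.funLeft_injective_of_surjective ℝ ℝ g hg)
    T).finrank_eq]
  exact Submodule.finrank_mono h

lemma finrank_headSpan_le (hm : ∀ i, 0 < m i) (T : Submodule ℝ ((∀ i, Fin (m i)) → ℝ)) :
    Module.finrank ℝ (headSpan T) ≤ Module.finrank ℝ (sliceSpan {0} T) := by
  refine finrank_le_of_map_funLeft_le (g := fun a : ∀ i, Fin (m i) => a 0)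
    (fun x => ⟨Fin.cons x fun i => ⟨0, hm i.succ⟩, rfl⟩) ?_
  rw [headSpan, Submodule.map_span_le]
  rintro _ ⟨t, ht, b, rfl⟩
  refine Submodule.subset_span ⟨t, ht, Fin.cons ⟨0, hm 0⟩ b, ?_⟩
  ext a
  simp only [LinearMap.funLeft_apply]
  congr 1
  ext i
  refine Fin.cases ?_ (fun i => ?_) i <;> simp

lemma finrank_sliceSpan_tailSpan_le (hm : ∀ i, 0 < m i) (S : Finset (Fin k))
    (T : Submodule ℝ ((∀ i, Fin (m i)) → ℝ)) :
    Module.finrank ℝ (sliceSpan S (tailSpan T)) ≤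
      Module.finrank ℝ (sliceSpan (S.map (Fin.succEmb k)) T) := by
  refine finrank_le_of_map_funLeft_le (g := fun (a : ∀ i, Fin (m i)) (i : Fin k) => a i.succ)
    (fun x => ⟨Fin.cons ⟨0, hm 0⟩ x, rfl⟩) ?_
  rw [sliceSpan, Submodule.map_span_le]
  rintro _ ⟨t, ht, b, rfl⟩
  induction ht using Submodule.span_induction with
  | mem x hx =>
    obtain ⟨t, ht, a, rfl⟩ := hx
    refine Submodule.subset_span ⟨t, ht, Fin.cons a b, ?_⟩
    ext c
    simp only [LinearMap.funLeft_apply]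
    congr 1
    ext i
    refine Fin.cases ?_ (fun i => ?_) i <;> simp
  | zero => exact zero_mem _
  | add x y _ _ hx hy => exact add_mem hx hy
  | smul c x _ hx => exact Submodule.smul_mem _ c hx

lemma map_succEmb_suffix (k j : ℕ) :
    (suffix k j).map (Fin.succEmb k) = suffix (k + 1) (j + 1) := by
  ext i
  refine Fin.cases ?_ (fun i => ?_) i <;> simp [suffix]

lemma finrank_tailSpan_le (hm : ∀ i, 0 < m i) (T : Submodule ℝ ((∀ i, Fin (m i)) → ℝ)) :
    Module.finrank ℝ (tailSpan T) ≤ Module.finrank ℝ (sliceSpan (suffix (k + 1) 1) T) := by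
  rw [← map_succEmb_suffix]
  refine le_trans (Submodule.finrank_mono fun t ht => ?_) (finrank_sliceSpan_tailSpan_le hm _ T)
  exact Submodule.subset_span ⟨t, ht, fun i => ⟨0, hm i.succ⟩, by simp [suffix]⟩

end Slices

section Cover

open scoped Matrix Matrix.Norms.L2Operator

/-- If `U * Uᴴ` fixes the first-coordinate fibers of `T` and `V * Vᴴ` fixes the remaining slices,
then their tensor product fixes `T`. -/
lemma consKronecker_mul_conjTranspose_mulVec {k r : ℕ} {m : Fin (k + 1) → ℕ}
    {T : Submodule ℝ ((∀ i, Fin (m i)) → ℝ)}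
    {U : Matrix (Fin (m 0)) (Fin r) ℝ} {V : Matrix (∀ i : Fin k, Fin (m i.succ)) (Fin r) ℝ}
    (hU : ∀ t ∈ headSpan T, (U * Uᴴ) *ᵥ t = t) (hV : ∀ t ∈ tailSpan T, (V * Vᴴ) *ᵥ t = t)
    {t : (∀ i, Fin (m i)) → ℝ} (ht : t ∈ T) :
    (consKronecker U V * (consKronecker U V)ᴴ) *ᵥ t = t := by
  have hK : ∀ a c, (consKronecker U V * (consKronecker U V)ᴴ) a c =
      (U * Uᴴ) (a 0) (c 0) * (V * Vᴴ) (fun i => a i.succ) (fun i => c i.succ) := by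
    intro a c
    simp only [Matrix.mul_apply, Fintype.sum_prod_type, Finset.sum_mul_sum, consKronecker,
      Matrix.of_apply, Matrix.conjTranspose_apply, star_trivial]
    exact Finset.sum_congr rfl fun p _ => Finset.sum_congr rfl fun q _ => by ring
  have hU' : ∀ a b, ∑ i, (U * Uᴴ) a i * t (Fin.cons i b) = t (Fin.cons a b) := fun a b =>
    congrFun (hU _ (Submodule.subset_span ⟨t, ht, b, rfl⟩)) a
  have hV' : ∀ a b, ∑ j, (V * Vᴴ) b j * t (Fin.cons a j) = t (Fin.cons a b) := fun a b =>
    congrFun (hV _ (Submodule.subset_span ⟨t, ht, a, rfl⟩)) b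
  ext a
  rw [Matrix.mulVec, dotProduct, sum_consIndex, Finset.sum_comm]
  simp only [hK, Fin.cons_zero, Fin.cons_succ]
  calc _ = ∑ j, (V * Vᴴ) (fun i => a i.succ) j * ∑ i, (U * Uᴴ) (a 0) i * t (Fin.cons i j) := by
        simp only [Finset.mul_sum]
        exact Finset.sum_congr rfl fun p _ => Finset.sum_congr rfl fun q _ => by ring
    _ = t a := by
        simp only [hU', hV']
        exact congrArg t (Fin.cons_self_tail a)

lemma exists_consKronecker_factorization {k r : ℕ} {m : Fin (k + 1) → ℕ}
    {T : Submodule ℝ ((∀ i, Fin (m i)) → ℝ)}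
    (hhead : Module.finrank ℝ (headSpan T) ≤ r) (htail : Module.finrank ℝ (tailSpan T) ≤ r)
    {W : Matrix (∀ i, Fin (m i)) (Fin r) ℝ} (hW : ‖W‖ ≤ 1) (hWT : ∀ p, W.col p ∈ T) :
    ∃ (U : Matrix (Fin (m 0)) (Fin r) ℝ) (V : Matrix (∀ i : Fin k, Fin (m i.succ)) (Fin r) ℝ)
      (C : Matrix (Fin r × Fin r) (Fin r) ℝ), ‖U‖ ≤ 1 ∧ ‖V‖ ≤ 1 ∧ ‖C‖ ≤ 1 ∧
        (∀ p, V.col p ∈ tailSpan T) ∧ W = consKronecker U V * C := by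
  obtain ⟨U, hU1, -, hU⟩ := exists_contraction_fixing _ hhead
  obtain ⟨V, hV1, hVT, hV⟩ := exists_contraction_fixing _ htail
  refine ⟨U, V, (consKronecker U V)ᴴ * W, hU1, hV1, ?_, hVT, ?_⟩
  · refine (Matrix.l2_opNorm_mul _ _).trans (mul_le_one₀ ?_ (norm_nonneg _) hW)
    rw [Matrix.l2_opNorm_conjTranspose]
    exact (norm_consKronecker_le U V).trans (mul_le_one₀ hU1 (norm_nonneg _) hV1)
  · rw [← Matrix.mul_assoc]
    ext a p
    exact (congrFun (consKronecker_mul_conjTranspose_mulVec hU hV (hWT p)) a).symm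

/-- Contractions whose columns lie in a space of tensors with tensor-train ranks at most `r` have
a small net in operator norm. -/
lemma exists_net_tensorTrain (r : ℕ) {δ : ℝ} (hδ0 : 0 < δ) (hδ1 : δ ≤ 1) (k : ℕ)
    (m : Fin (k + 1) → ℕ) (hm : ∀ i, 0 < m i) :
    ∃ N : Finset (Matrix (∀ i, Fin (m i)) (Fin r) ℝ),
      (N.card : ℝ) ≤ (3 / δ) ^ (k * r ^ 3 + (∑ i, m i) * r) ∧ (∀ Y ∈ N, ‖Y‖ ≤ 1) ∧
      ∀ T : Submodule ℝ ((∀ i, Fin (m i)) → ℝ),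
        (∀ i, Module.finrank ℝ (sliceSpan {i} T) ≤ r) →
        (∀ j, 1 ≤ j → j ≤ k → Module.finrank ℝ (sliceSpan (suffix (k + 1) j) T) ≤ r) →
        ∀ W : Matrix (∀ i, Fin (m i)) (Fin r) ℝ, ‖W‖ ≤ 1 → (∀ p, W.col p ∈ T) →
          ∃ Y ∈ N, ‖W - Y‖ ≤ (2 * k + 1) * δ := by
  classical
  induction k with
  | zero =>
    obtain ⟨N, hcard, hN1, hN⟩ :=
      exists_net_unitBall (Matrix (∀ i, Fin (m i)) (Fin r) ℝ) hδ0 hδ1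
    refine ⟨N, ?_, hN1, fun T _ _ W hW _ => by simpa using hN W hW⟩
    simpa [Module.finrank_matrix] using hcard
  | succ k ih =>
    obtain ⟨N₁, hcard₁, hN₁1, hN₁⟩ :=
      exists_net_unitBall (Matrix (Fin (m 0)) (Fin r) ℝ) hδ0 hδ1
    obtain ⟨N₂, hcard₂, hN₂1, hN₂⟩ := ih (fun i => m i.succ) fun i => hm i.succ
    obtain ⟨N₃, hcard₃, hN₃1, hN₃⟩ :=
      exists_net_unitBall (Matrix (Fin r × Fin r) (Fin r) ℝ) hδ0 hδ1
    refine ⟨(N₁ ×ˢ N₂ ×ˢ N₃).image fun x => consKronecker x.1 x.2.1 * x.2.2, ?_, ?_, ?_⟩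
    · calc _ ≤ (((N₁ ×ˢ N₂ ×ˢ N₃).card : ℕ) : ℝ) := by exact_mod_cast Finset.card_image_le
        _ = N₁.card * (N₂.card * N₃.card) := by simp
        _ ≤ (3 / δ) ^ (m 0 * r) * ((3 / δ) ^ (k * r ^ 3 + (∑ i : Fin (k + 1), m i.succ) * r) *
              (3 / δ) ^ (r * r * r)) := by
            simp only [Module.finrank_matrix, Module.finrank_self, Fintype.card_fin,
              Fintype.card_prod, mul_one] at hcard₁ hcard₃
            gcongr
        _ = _ := by
            rw [← pow_add, ← pow_add, Fin.sum_univ_succ m]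
            congr 1
            ring
    · simp only [Finset.mem_image, Finset.mem_product, forall_exists_index, and_imp]
      rintro _ ⟨U, V, C⟩ hU hV hC rfl
      exact (Matrix.l2_opNorm_mul _ _).trans (mul_le_one₀ ((norm_consKronecker_le U V).trans
        (mul_le_one₀ (hN₁1 U hU) (norm_nonneg _) (hN₂1 V hV))) (norm_nonneg _) (hN₃1 C hC))
    · intro T hleaf hsuffix W hW hWT
      obtain ⟨U, V, C, hU, hV, hC, hVT, rfl⟩ := exists_consKronecker_factorization
        ((finrank_headSpan_le hm T).trans (hleaf 0))
        ((finrank_tailSpan_le hm T).trans (hsuffix 1 le_rfl (by omega))) hW hWT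
      obtain ⟨U', hU', hUU'⟩ := hN₁ U hU
      obtain ⟨C', hC', hCC'⟩ := hN₃ C hC
      obtain ⟨V', hV', hVV'⟩ := hN₂ (tailSpan T)
        (fun i => (finrank_sliceSpan_tailSpan_le hm _ T).trans
          (by rw [Finset.map_singleton]; exact hleaf i.succ))
        (fun j _ hj => (finrank_sliceSpan_tailSpan_le hm _ T).trans
          (by rw [map_succEmb_suffix]; exact hsuffix (j + 1) (by omega) (by omega)))
        V hV hVT
      refine ⟨_, Finset.mem_image_of_mem _ (Finset.mk_mem_product hU'
        (Finset.mk_mem_product hV' hC')), ?_⟩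
      refine (norm_consKronecker_mul_sub_le (hN₁1 U' hU') hV (hN₂1 V' hV') hC).trans ?_
      push_cast
      linarith

end Cover

theorem covering_number_TT
    (d : ℕ) (hd : 3 ≤ d) (n : Fin d → ℕ) (hn : ∀ i, 0 < n i)
    (r : ℕ) (hr : 1 ≤ r)
    (ε : ℝ) (hε0 : 0 < ε) (hε1 : ε ≤ 1) :
    ∃ N : Finset ((∀ i, Fin (n i)) → ℝ),
      (N.card : ℝ) ≤ (3 * (2 * (d : ℝ) - 1) * Real.sqrt r / ε)
          ^ ((d - 1) * r ^ 3 + d * (Finset.univ.sup n) * r) ∧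
      ∀ X : (∀ i, Fin (n i)) → ℝ,
        (∀ k : Fin d, (matricize n ℝ {k} X).rank ≤ r) →
        (∀ j : ℕ, 2 ≤ j → j ≤ d - 1 →
          (matricize n ℝ (Finset.univ.filter fun i : Fin d => j ≤ (i : ℕ) + 1) X).rank ≤ r) →
        frob X = 1 →
        ∃ Y ∈ N, frob (X - Y) ≤ ε := by
  classical
  obtain ⟨k, rfl⟩ : ∃ k, d = k + 1 := ⟨d - 1, by omega⟩
  have hk : (0 : ℝ) < 2 * k + 1 := by positivity
  have hδ0 : 0 < ε / (2 * k + 1) := by positivity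
  have hδ1 : ε / (2 * k + 1) ≤ 1 := (div_le_one hk).2 (by linarith [k.cast_nonneg (α := ℝ)])
  obtain ⟨N, hcard, -, hN⟩ := exists_net_tensorTrain r hδ0 hδ1 k n hn
  let p₀ : Fin r := ⟨0, hr⟩
  have hsqrt : 1 ≤ Real.sqrt r := Real.one_le_sqrt.2 (by exact_mod_cast hr)
  refine ⟨N.image fun Y => Y.mulVec (Pi.single p₀ 1), ?_, fun X hleaf hsuffix hX => ?_⟩
  · have hbase : 3 / (ε / (2 * k + 1)) ≤
        3 * (2 * ((k + 1 : ℕ) : ℝ) - 1) * Real.sqrt r / ε := by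
      rw [div_div_eq_mul_div]
      refine div_le_div_of_nonneg_right ?_ hε0.le
      push_cast
      nlinarith
    have hbase1 : 1 ≤ 3 / (ε / (2 * k + 1)) := (one_le_div hδ0).2 (by linarith)
    have hsum : ∑ i, n i ≤ (k + 1) * Finset.univ.sup n := by
      simpa using Finset.sum_le_card_nsmul Finset.univ n _ fun i hi => Finset.le_sup hi
    calc _ ≤ (N.card : ℝ) := by exact_mod_cast Finset.card_image_le
      _ ≤ _ := hcard
      _ ≤ (3 / (ε / (2 * k + 1))) ^
            ((k + 1 - 1) * r ^ 3 + (k + 1) * (Finset.univ.sup n) * r) := by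
          refine pow_le_pow_right₀ hbase1 ?_
          rw [Nat.add_sub_cancel]
          gcongr
      _ ≤ _ := by gcongr
  · let W : Matrix (∀ i, Fin (n i)) (Fin r) ℝ := Matrix.of fun a p => if p = p₀ then X a else 0
    have hWX : ∀ x, W.mulVec x = fun a => X a * x p₀ := fun x => by
      ext a
      simp [W, Matrix.mulVec, dotProduct]
    have hXsq : ∑ a, X a ^ 2 = 1 := by
      rwa [frob, Real.sqrt_eq_one] at hX
    have hW : open scoped Matrix.Norms.L2Operator in ‖W‖ ≤ 1 := by
      refine l2_opNorm_le_of_sum_sq zero_le_one fun x => ?_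
      simp only [hWX, mul_pow, ← Finset.sum_mul, hXsq, one_pow, one_mul]
      exact Finset.single_le_sum (f := fun p => x p ^ 2) (fun p _ => sq_nonneg _)
        (Finset.mem_univ p₀)
    have hcol : ∀ p, W.col p ∈ Submodule.span ℝ {X} := fun p => by
      refine Submodule.mem_span_singleton.2 ⟨if p = p₀ then 1 else 0, ?_⟩
      ext a
      simp [W]
    have hrank : ∀ j, 1 ≤ j → j ≤ k → (matricize n ℝ (suffix (k + 1) j) X).rank ≤ r := by
      intro j hj1 hjk
      rcases hjk.lt_or_eq with hlt | rfl
      · convert hsuffix (j + 1) (by omega) (by omega) using 3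
        simp [suffix]
      · convert hleaf (Fin.last j) using 3
        ext i
        simp only [suffix, Finset.mem_filter, Finset.mem_univ, true_and, Finset.mem_singleton,
          Fin.ext_iff, Fin.val_last]
        omega
    obtain ⟨Y, hY, hWY⟩ := hN (Submodule.span ℝ {X})
      (fun i => (finrank_sliceSpan_span_singleton_le _ X).trans (hleaf i))
      (fun j hj1 hjk => (finrank_sliceSpan_span_singleton_le _ X).trans (hrank j hj1 hjk)) W hW hcol
    refine ⟨_, Finset.mem_image_of_mem _ hY, ?_⟩
    have hdiff : X - Y.mulVec (Pi.single p₀ 1) = (W - Y).mulVec (Pi.single p₀ 1) := by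
      rw [Matrix.sub_mulVec, hWX]
      simp
    have hunit : frob (Pi.single p₀ 1 : Fin r → ℝ) = 1 := by
      simp [frob, Pi.single_apply]
    rw [hdiff]
    refine (frob_mulVec_le _ _).trans ?_
    rw [hunit, mul_one]
    exact hWY.trans_eq (mul_div_cancel₀ _ hk.ne')
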